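/- Let X be a nonnegative integrable random variable with tail distribution F̄(x) = P(X > x). If F̄ is log-convex on [0,∞), then the mean residual life is non-decreasing: for all 0 ≤ t₁ ≤ t₂ with F̄(t₂) > 0, (∫₀^∞ F̄(t₂ + x) dx) / F̄(t₂) ≥ (∫₀^∞ F̄(t₁ + x) dx) / F̄(t₁). Equivalently, E[X − t | X > t] is non-decreasing in t on the set where F̄(t) > 0. -/

import Mathlib

open MeasureTheory ProbabilityTheory

/-- If `X` is a nonnegative integrable random variable whose tail distribution
`F̄(x) = P(X > x)` is log-convex on `[0, ∞)`, then the mean residual life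
`E[X − t | X > t] = (∫₀^∞ F̄(t + x) dx) / F̄(t)` is non-decreasing in `t` on the
set where `F̄(t) > 0`. -/
theorem mean_residual_life_monotone_of_logConvex_tail
    {Ω : Type*} [MeasurableSpace Ω] (μ : Measure Ω) [IsProbabilityMeasure μ]
    (X : Ω → ℝ) (hX : Measurable X) (hnonneg : ∀ ω, 0 ≤ X ω)
    (hint : Integrable X μ)
    (F : ℝ → ℝ) (hF : ∀ x, F x = (μ {ω | X ω > x}).toReal)
    (hlogconvex : ∀ x ≥ (0:ℝ), ∀ y ≥ (0:ℝ), ∀ θ ∈ Set.Icc (0:ℝ) 1,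
      F (θ * x + (1 - θ) * y) ≤ F x ^ θ * F y ^ (1 - θ)) :
    ∀ t₁ t₂ : ℝ, 0 ≤ t₁ → t₁ ≤ t₂ → 0 < F t₂ →
      (∫ x in Set.Ioi (0:ℝ), F (t₁ + x)) / F t₁ ≤
        (∫ x in Set.Ioi (0:ℝ), F (t₂ + x)) / F t₂ := by
  have h0 : ∀ x, 0 ≤ F x := fun x => by rw [hF]; exact ENNReal.toReal_nonneg
  have hanti : Antitone F := by
    intro a b hab
    rw [hF, hF]
    refine ENNReal.toReal_mono (measure_ne_top _ _) (measure_mono ?_)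
    intro ω hω
    simp only [Set.mem_setOf_eq] at hω ⊢
    linarith
  have hFint : IntegrableOn F (Set.Ioi 0) := by
    refine ⟨hanti.measurable.aestronglyMeasurable, ?_⟩
    rw [hasFiniteIntegral_iff_ofReal (Filter.Eventually.of_forall h0)]
    have h1 := lintegral_eq_lintegral_meas_lt μ (Filter.Eventually.of_forall hnonneg)
      hX.aemeasurable
    have h2 : ∀ x, ENNReal.ofReal (F x) = μ {ω | x < X ω} := by
      intro x
      rw [hF, ENNReal.ofReal_toReal (measure_ne_top _ _)]
    simp_rw [h2]
    rw [← h1]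
    exact (hasFiniteIntegral_iff_ofReal (Filter.Eventually.of_forall hnonneg)).1 hint.2
  have hshift : ∀ t, 0 ≤ t → IntegrableOn (fun x => F (t + x)) (Set.Ioi 0) := by
    intro t ht
    refine Integrable.mono hFint
      (hanti.measurable.comp (measurable_const_add t)).aestronglyMeasurable
      (Filter.Eventually.of_forall fun x => ?_)
    rw [Real.norm_of_nonneg (h0 _), Real.norm_of_nonneg (h0 _)]
    exact hanti (by linarith)
  intro t₁ t₂ ht₁ h12 hpos
  have hpos1 : 0 < F t₁ := lt_of_lt_of_le hpos (hanti h12)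
  rw [div_le_div_iff₀ hpos1 hpos, ← integral_mul_const, ← integral_mul_const]
  refine setIntegral_mono_on ((hshift t₁ ht₁).mul_const _)
    ((hshift t₂ (ht₁.trans h12)).mul_const _) measurableSet_Ioi ?_
  intro x hx
  have hx : 0 < x := hx
  have hd : 0 < t₂ - t₁ + x := by linarith
  obtain ⟨θ, hθ⟩ : ∃ θ, θ = x / (t₂ - t₁ + x) := ⟨_, rfl⟩
  have hθ0 : 0 ≤ θ := by rw [hθ]; positivity
  have hθ1 : θ ≤ 1 := by rw [hθ, div_le_one hd]; linarith
  have hmul : θ * (t₂ - t₁ + x) = x := by rw [hθ]; field_simp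
  have hb : 0 ≤ t₂ + x := by linarith
  have e1 := hlogconvex t₁ ht₁ (t₂ + x) hb θ ⟨hθ0, hθ1⟩
  have e2 := hlogconvex (t₂ + x) hb t₁ ht₁ θ ⟨hθ0, hθ1⟩
  rw [show θ * t₁ + (1 - θ) * (t₂ + x) = t₂ by linarith] at e1
  rw [show θ * (t₂ + x) + (1 - θ) * t₁ = t₁ + x by linarith] at e2
  have key : ∀ a : ℝ, 0 ≤ a → a ^ θ * a ^ (1 - θ) = a := by
    intro a ha
    rw [← Real.rpow_add_of_nonneg ha hθ0 (by linarith), add_sub_cancel, Real.rpow_one]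
  calc F (t₁ + x) * F t₂
      ≤ (F (t₂ + x) ^ θ * F t₁ ^ (1 - θ)) * (F t₁ ^ θ * F (t₂ + x) ^ (1 - θ)) :=
        mul_le_mul e2 e1 (h0 _) ((h0 _).trans e2)
    _ = (F (t₂ + x) ^ θ * F (t₂ + x) ^ (1 - θ)) * (F t₁ ^ θ * F t₁ ^ (1 - θ)) := by ring
    _ = F (t₂ + x) * F t₁ := by rw [key _ (h0 _), key _ (h0 _)]
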